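/- Let δ ∈ [0,1], and suppose there exist a ∈ H and r₀ > 0 with the closed ball B̄(a, r₀) contained in C. Define Π^δ z = P z − δ·(z − P z). Then there exists a map Π∞ : H → H such that for every z ∈ H the sequence of iterates n ↦ (Π^δ)^[n] z converges to Π∞ z, and Π∞ is a generalized projection onto C: Π∞ z ∈ C for all z ∈ H, Π∞ z = z for all z ∈ C, and ‖Π∞ x − Π∞ y‖ ≤ ‖x − y‖ for all x, y ∈ H. -/

import Mathlib

open scoped RealInnerProductSpace

/-- Inner products with a vector `d` grow by `r * ‖d‖` when the base point moves to the far side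
of a ball of radius `r`. -/
theorem mul_norm_le_inner_sub_center {H : Type*} [NormedAddCommGroup H] [InnerProductSpace ℝ H]
    {a : H} {r : ℝ} (hr : 0 ≤ r) {d p : H}
    (h : ∀ c ∈ Metric.closedBall a r, 0 ≤ ⟪d, p - c⟫) : r * ‖d‖ ≤ ⟪d, p - a⟫ := by
  rcases eq_or_ne d 0 with rfl | hd
  · simp
  have hd' : ‖d‖ ≠ 0 := norm_ne_zero_iff.mpr hd
  have hc := h (a + (r / ‖d‖) • d) (by
    simp [Metric.mem_closedBall, norm_smul, abs_of_nonneg hr, hd'])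
  rw [← sub_sub, inner_sub_right, real_inner_smul_right, real_inner_self_eq_norm_sq] at hc
  have : r / ‖d‖ * ‖d‖ ^ 2 = r * ‖d‖ := by field_simp
  linarith

/-- A sequence whose steps are controlled by the decrease of the squared distance to a point is
Cauchy. -/
theorem cauchySeq_of_mul_dist_le_sq_norm_sub {H : Type*} [NormedAddCommGroup H]
    {u : ℕ → H} {a : H} {r : ℝ} (hr : 0 < r)
    (h : ∀ n, r * dist (u n) (u (n + 1)) ≤ ‖u n - a‖ ^ 2 - ‖u (n + 1) - a‖ ^ 2) :
    CauchySeq u := by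
  apply cauchySeq_of_summable_dist
  apply summable_of_sum_range_le (c := ‖u 0 - a‖ ^ 2 / r) (fun _ => dist_nonneg)
  intro n
  rw [le_div_iff₀ hr, mul_comm, Finset.mul_sum]
  calc ∑ i ∈ Finset.range n, r * dist (u i) (u (i + 1))
      ≤ ∑ i ∈ Finset.range n, (‖u i - a‖ ^ 2 - ‖u (i + 1) - a‖ ^ 2) :=
        Finset.sum_le_sum fun i _ => h i
    _ = ‖u 0 - a‖ ^ 2 - ‖u n - a‖ ^ 2 := Finset.sum_range_sub' (fun i => ‖u i - a‖ ^ 2) n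
    _ ≤ ‖u 0 - a‖ ^ 2 := sub_le_self _ (sq_nonneg _)

/-- Over-relaxing a firmly nonexpansive displacement `u` of `v` does not increase the norm. -/
theorem norm_sub_smul_sub_le_of_sq_norm_le_inner {H : Type*} [NormedAddCommGroup H]
    [InnerProductSpace ℝ H] {u v : H} {δ : ℝ} (hδ : δ ∈ Set.Icc (0 : ℝ) 1)
    (h : ‖u‖ ^ 2 ≤ ⟪u, v⟫) : ‖u - δ • (v - u)‖ ≤ ‖v‖ := by
  obtain ⟨h0, h1⟩ := hδ
  have huv : ‖u‖ ^ 2 ≤ ‖v‖ ^ 2 := by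
    nlinarith [real_inner_le_norm u v, sq_nonneg (‖u‖ - ‖v‖)]
  refine le_of_sq_le_sq ?_ (norm_nonneg v)
  have hexp : ‖u - δ • (v - u)‖ ^ 2
      = (1 + δ) ^ 2 * ‖u‖ ^ 2 - 2 * (δ * (1 + δ)) * ⟪u, v⟫ + δ ^ 2 * ‖v‖ ^ 2 := by
    simp only [← real_inner_self_eq_norm_sq, inner_sub_left, inner_sub_right,
      real_inner_smul_left, real_inner_smul_right, real_inner_comm u v]
    ring
  have h2 : 0 ≤ δ * (1 + δ) := by positivity
  have h3 : 0 ≤ 1 - δ ^ 2 := by nlinarith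
  rw [hexp]
  nlinarith [mul_le_mul_of_nonneg_left h h2, mul_le_mul_of_nonneg_left huv h3]

theorem stmt_2 {H : Type*} [NormedAddCommGroup H] [InnerProductSpace ℝ H] [CompleteSpace H]
    (C : Set H) (hCne : C.Nonempty) (hCcl : IsClosed C) (hCcv : Convex ℝ C)
    (P : H → H)
    (hP : ∀ z : H, P z ∈ C ∧ ∀ c ∈ C, ⟪P z - z, P z - c⟫ ≤ 0)
    (δ : ℝ) (hδ : δ ∈ Set.Icc (0 : ℝ) 1)
    (a : H) (r₀ : ℝ) (hr₀ : 0 < r₀) (hball : Metric.closedBall a r₀ ⊆ C)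
    (Pd : H → H) (hPd : ∀ z : H, Pd z = P z - δ • (z - P z)) :
    ∃ Pinf : H → H,
      (∀ z : H, Filter.Tendsto (fun n : ℕ => Pd^[n] z) Filter.atTop (nhds (Pinf z))) ∧
      (∀ z : H, Pinf z ∈ C) ∧
      (∀ z ∈ C, Pinf z = z) ∧
      (∀ x y : H, ‖Pinf x - Pinf y‖ ≤ ‖x - y‖) := by
  obtain ⟨h0, h1⟩ := hδ
  have hstep (z : H) : Pd z = z - (1 + δ) • (z - P z) := by rw [hPd]; module
  have hdist (z : H) : dist z (Pd z) = (1 + δ) * ‖z - P z‖ := by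
    rw [hstep, dist_eq_norm, sub_sub_cancel, norm_smul, Real.norm_of_nonneg (by linarith)]
  have hvar (z c : H) (hc : c ∈ C) : 0 ≤ ⟪z - P z, P z - c⟫ := by
    have := (hP z).2 c hc
    rw [← neg_sub, inner_neg_left] at this
    linarith
  have hfix (z : H) (hz : z ∈ C) : P z = z := by
    have := (hP z).2 z hz
    rw [real_inner_self_nonpos, sub_eq_zero] at this
    exact this
  have hdec (z : H) : 2 * r₀ * dist z (Pd z) ≤ ‖z - a‖ ^ 2 - ‖Pd z - a‖ ^ 2 := by
    have hin := mul_norm_le_inner_sub_center hr₀.le fun c hc => hvar z c (hball hc)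
    have e1 : z - a = (P z - a) + (z - P z) := by abel
    have e2 : Pd z - a = (P z - a) - δ • (z - P z) := by rw [hPd]; abel
    rw [hdist, e1, e2, norm_add_sq_real, norm_sub_sq_real (P z - a) (δ • (z - P z)),
      real_inner_smul_right, norm_smul, Real.norm_of_nonneg h0, real_inner_comm]
    nlinarith [mul_le_mul_of_nonneg_left hin (by linarith : 0 ≤ 1 + δ),
      mul_nonneg (by nlinarith : 0 ≤ 1 - δ ^ 2) (sq_nonneg ‖z - P z‖)]
  have hlip (x y : H) : ‖Pd x - Pd y‖ ≤ ‖x - y‖ := by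
    have hfirm : ‖P x - P y‖ ^ 2 ≤ ⟪P x - P y, x - y⟫ := by
      have hx := hvar x (P y) (hP y).1
      have hy := hvar y (P x) (hP x).1
      have : ⟪P x - P y, x - y⟫
          = ‖P x - P y‖ ^ 2 + ⟪x - P x, P x - P y⟫ + ⟪y - P y, P y - P x⟫ := by
        rw [← real_inner_self_eq_norm_sq, ← neg_sub (P x) (P y), inner_neg_right,
          real_inner_comm (P x - P y) (x - P x), real_inner_comm (P x - P y) (y - P y),
          ← sub_eq_add_neg, ← inner_add_right, ← inner_sub_right]
        congr 1
        abel
      linarith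
    have e : Pd x - Pd y = (P x - P y) - δ • ((x - y) - (P x - P y)) := by
      rw [hPd, hPd]; module
    rw [e]
    exact norm_sub_smul_sub_le_of_sq_norm_le_inner ⟨h0, h1⟩ hfirm
  have hlip_iter (x y : H) (n : ℕ) : ‖Pd^[n] x - Pd^[n] y‖ ≤ ‖x - y‖ := by
    induction n with
    | zero => exact le_rfl
    | succ n ih =>
      rw [Function.iterate_succ_apply', Function.iterate_succ_apply']
      exact (hlip _ _).trans ih
  have hcauchy (z : H) : CauchySeq fun n : ℕ => Pd^[n] z :=
    cauchySeq_of_mul_dist_le_sq_norm_sub (a := a) (by positivity : 0 < 2 * r₀) fun n => by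
      rw [Function.iterate_succ_apply']
      exact hdec _
  choose Pinf hPinf using fun z => cauchySeq_tendsto_of_complete (hcauchy z)
  refine ⟨Pinf, hPinf, fun z => ?_, fun z hz => ?_, fun x y => ?_⟩
  · have hsucc : Filter.Tendsto (fun n : ℕ => dist (Pd^[n] z) (Pd^[n + 1] z)) Filter.atTop
        (nhds 0) := by
      simpa using (hPinf z).dist ((Filter.tendsto_add_atTop_iff_nat 1).mpr (hPinf z))
    have hproj : Filter.Tendsto (fun n : ℕ => dist (Pd^[n] z) (P (Pd^[n] z))) Filter.atTop
        (nhds 0) := by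
      refine squeeze_zero (fun _ => dist_nonneg) (fun n => ?_) hsucc
      rw [Function.iterate_succ_apply', hdist, dist_eq_norm]
      nlinarith [norm_nonneg (Pd^[n] z - P (Pd^[n] z))]
    exact hCcl.mem_of_tendsto ((hPinf z).congr_dist hproj)
      (Filter.Eventually.of_forall fun n => (hP _).1)
  · have hz' : Pd z = z := by simp [hPd, hfix z hz]
    refine tendsto_nhds_unique (hPinf z) ?_
    simp only [Function.iterate_fixed hz']
    exact tendsto_const_nhds
  · exact le_of_tendsto ((hPinf x).sub (hPinf y)).norm
      (Filter.Eventually.of_forall (hlip_iter x y))
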